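/- arXiv:1612.04571 — 3 statements merged into one kernel-verified Lean document; each statement's English description precedes it below -/
import Mathlib

section
/- Let x_0, x_1, …, x_n ∈ ℝ^d with n ≥ 1, let r > 0, β > 0, α ≥ 1 and p ∈ (0,1). Let N_β = |{(i,j) : 1 ≤ i < j ≤ n, ‖x_i − x_j‖₂ ≤ βr}|, set M = (1 + 4α/β)^{d/2} · √(2N_β + n), and choose the real parameter K = (1/α) · log M / log(1/p). Then p^{−K} · (1 + Σ_{i : ‖x_i − x_0‖₂ ≥ αr} p^{K·‖x_i − x_0‖₂ / r}) ≤ 3 · (1 + 4α/β)^{d/(2α)} · (2N_β + n)^{1/(2α)}. -/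
open Finset

/-- Elements of a finite set ranked by `t`: if each weight is at most an antitone function of the
rank, the total weight is at most the sum of that function over all ranks. -/
lemma Finset.sum_le_sum_range_of_le_rank {ι : Type*} [DecidableEq ι] (f : ℕ → ℝ)
    (hf : Antitone f) (t w : ι → ℝ) (s : Finset ι)
    (h : ∀ i ∈ s, w i ≤ f (#{j ∈ s | t j ≤ t i})) :
    ∑ i ∈ s, w i ≤ ∑ k ∈ range #s, f (k + 1) := by
  induction s using Finset.induction_on_max_value t with
  | empty => simp
  | insert a s ha hmax ih =>
    rw [sum_insert ha, card_insert_of_notMem ha, sum_range_succ, add_comm]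
    gcongr
    · exact ih fun i hi => (h i (mem_insert_of_mem hi)).trans
        (hf (card_le_card (filter_subset_filter _ (subset_insert a s))))
    · have h_all : ({j ∈ insert a s | t j ≤ t a} : Finset ι) = insert a s := by
        refine filter_true_of_mem fun j hj => ?_
        rcases mem_insert.1 hj with rfl | hj
        · exact le_rfl
        · exact hmax j hj
      have := h a (mem_insert_self a s)
      rwa [h_all, card_insert_of_notMem ha] at this

lemma sum_range_min_inv_div_sq_le_two {M : ℝ} (hM : 0 < M) (n : ℕ) :
    ∑ k ∈ range n, min M⁻¹ (M / ((k + 1 : ℕ) : ℝ) ^ 2) ≤ 2 := by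
  have key : ∀ n : ℕ, ((n : ℝ) ≤ M → ∑ k ∈ range n, min M⁻¹ (M / ((k + 1 : ℕ) : ℝ) ^ 2) ≤ n / M) ∧
      (M ≤ n → ∑ k ∈ range n, min M⁻¹ (M / ((k + 1 : ℕ) : ℝ) ^ 2) ≤ 2 - M / n) := by
    intro n
    induction n with
    | zero => exact ⟨fun _ => by simp, fun h => absurd h (by simpa using hM)⟩
    | succ n ih =>
      rw [sum_range_succ]
      have hn : (0 : ℝ) ≤ n := n.cast_nonneg
      push_cast
      have h_left := min_le_left M⁻¹ (M / ((n : ℝ) + 1) ^ 2)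
      have h_right := min_le_right M⁻¹ (M / ((n : ℝ) + 1) ^ 2)
      push_cast at ih
      refine ⟨fun h => ?_, fun h => ?_⟩
      · have := ih.1 (by linarith)
        rw [add_div, one_div]
        linarith
      · rcases le_total (n : ℝ) M with hnM | hnM
        · have := ih.1 hnM
          have : (n : ℝ) / M + M / (n + 1) ^ 2 ≤ 2 - M / (n + 1) := by
            rw [← sub_nonneg]
            have : 2 - M / ((n : ℝ) + 1) - (n / M + M / (n + 1) ^ 2) =
                ((M - n) * (n + 1 - M) * (n + 1) + (n + 1 - M) * M) / (M * (n + 1) ^ 2) := by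
              field_simp
              ring
            rw [this]
            have h₁ : 0 ≤ M - n := by linarith
            have h₂ : 0 ≤ (n : ℝ) + 1 - M := by linarith
            positivity
          linarith
        · have := ih.2 hnM
          have hn0 : (0 : ℝ) < n := hM.trans_le hnM
          have : M / ((n : ℝ) + 1) ^ 2 ≤ M / n - M / (n + 1) := by
            rw [div_sub_div _ _ hn0.ne' (by positivity),
              div_le_div_iff₀ (by positivity) (by positivity)]
            have : 0 ≤ M * ((n : ℝ) + 1) := by positivity
            nlinarith
          linarith
  rcases le_total (n : ℝ) M with h | h
  · exact ((key n).1 h).trans (((div_le_one hM).2 h).trans one_le_two)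
  · have : 0 ≤ M / n := by positivity
    linarith [(key n).2 h]

lemma sq_le_mul_rpow_add_one {S E τ k : ℝ} (hS : 1 ≤ S) (hE : 1 ≤ E) (hτ : 1 ≤ τ) (hk : 0 ≤ k)
    (hkE : k ≤ S * E ^ τ) (hkS : k ≤ S ^ 2) : k ^ 2 ≤ (E * S) ^ (τ + 1) := by
  have hS0 : 0 < S := by linarith
  have hE0 : 0 < E := by linarith
  have expand : (E * S) ^ (τ + 1) = S ^ 2 * E ^ τ * E * S ^ (τ - 1) := by
    have hSτ : S ^ (τ + 1) = S ^ (τ - 1) * S ^ 2 := by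
      rw [← Real.rpow_natCast S 2, ← Real.rpow_add hS0]
      norm_num
      ring_nf
    rw [Real.mul_rpow hE0.le hS0.le, hSτ, Real.rpow_add_one hE0.ne']
    ring
  rw [expand]
  rcases le_total E S with h | h
  · have hpow : E ^ τ = E * E ^ (τ - 1) := by
      rw [Real.rpow_sub_one hE0.ne']
      field_simp
    calc k ^ 2 ≤ (S * E ^ τ) ^ 2 := by gcongr
      _ = S ^ 2 * E ^ τ * E * E ^ (τ - 1) := by rw [mul_pow, sq (E ^ τ)]; nth_rw 2 [hpow]; ring
      _ ≤ S ^ 2 * E ^ τ * E * S ^ (τ - 1) := by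
        gcongr
  · calc k ^ 2 = k * k := sq k
      _ ≤ (S * E ^ τ) * S ^ 2 := by gcongr
      _ = S ^ 2 * E ^ τ * S * 1 := by ring
      _ ≤ S ^ 2 * E ^ τ * E * S ^ (τ - 1) := by
        gcongr
        exact Real.one_le_rpow hS (by linarith)

open MeasureTheory in
/-- Volumetric bound on the size of a `δ`-separated family inside a ball of radius `R`. -/
lemma card_le_of_separated_of_mem_closedBall {ι E : Type*} [NormedAddCommGroup E]
    [NormedSpace ℝ E] [FiniteDimensional ℝ E] (x₀ : E) (x : ι → E) {R δ : ℝ} (hR : 0 ≤ R)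
    (hδ : 0 < δ) (P : Finset ι) (hP : ∀ i ∈ P, dist (x i) x₀ ≤ R)
    (hsep : ∀ i ∈ P, ∀ j ∈ P, i ≠ j → δ ≤ dist (x i) (x j)) :
    (#P : ℝ) ≤ (1 + 2 * R / δ) ^ Module.finrank ℝ E := by
  borelize E
  let μ : Measure E := Measure.addHaar
  have h_union : ∑ i ∈ P, μ (Metric.ball (x i) (δ / 2)) ≤ μ (Metric.ball x₀ (R + δ / 2)) := by
    rw [← measure_biUnion_finset]
    · refine measure_mono (Set.iUnion₂_subset fun i hi => Metric.ball_subset_ball' ?_)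
      linarith [hP i hi]
    · intro i hi j hj hij
      exact Metric.ball_disjoint_ball (by linarith [hsep i hi j hj hij])
    · exact fun i _ => Metric.isOpen_ball.measurableSet
  simp only [μ.addHaar_ball_of_pos _ (half_pos hδ),
    μ.addHaar_ball_of_pos _ (show 0 < R + δ / 2 by positivity), sum_const, nsmul_eq_mul] at h_union
  rw [← mul_assoc, ENNReal.mul_le_mul_iff_left (Metric.measure_ball_pos μ _ one_pos).ne'
    measure_ball_lt_top.ne, ← ENNReal.ofReal_natCast, ← ENNReal.ofReal_mul (by positivity),
    ENNReal.ofReal_le_ofReal_iff (by positivity)] at h_union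
  have h_ratio : 1 + 2 * R / δ = (R + δ / 2) / (δ / 2) := by
    field_simp
    ring
  rw [h_ratio, div_pow, le_div_iff₀ (by positivity)]
  exact h_union

lemma exists_maximal_separated {ι X : Type*} [DecidableEq ι] [PseudoMetricSpace X] (x : ι → X)
    {δ : ℝ} (hδ : 0 < δ) (A : Finset ι) :
    ∃ P ⊆ A, (∀ i ∈ P, ∀ j ∈ P, i ≠ j → δ ≤ dist (x i) (x j)) ∧
      ∀ i ∈ A, ∃ c ∈ P, dist (x i) (x c) < δ := by
  induction A using Finset.induction_on with
  | empty => exact ⟨∅, by simp⟩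
  | insert a A ha ih =>
    obtain ⟨P, hPA, hsep, hcov⟩ := ih
    by_cases h : ∃ c ∈ P, dist (x a) (x c) < δ
    · refine ⟨P, hPA.trans (subset_insert a A), hsep, fun i hi => ?_⟩
      rcases mem_insert.1 hi with rfl | hi
      exacts [h, hcov i hi]
    · push Not at h
      refine ⟨insert a P, insert_subset_insert a hPA, fun i hi j hj hij => ?_, fun i hi => ?_⟩
      · rcases mem_insert.1 hi with rfl | hi <;> rcases mem_insert.1 hj with rfl | hj
        · exact absurd rfl hij
        · exact h j hj
        · exact (h i (by assumption)).trans_eq (dist_comm _ _)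
        · exact hsep i hi j hj hij
      · rcases mem_insert.1 hi with rfl | hi
        · exact ⟨i, mem_insert_self i P, by simpa using hδ⟩
        · obtain ⟨c, hc, hic⟩ := hcov i hi
          exact ⟨c, mem_insert_of_mem hc, hic⟩

/-- The points of a family lying in a ball of radius `R`, counted against the ordered pairs of
points at distance at most `ρ`. -/
lemma card_sq_le_mul_card_near_pairs {ι E : Type*} [Fintype ι] [DecidableEq ι]
    [NormedAddCommGroup E] [NormedSpace ℝ E] [FiniteDimensional ℝ E] (x₀ : E) (x : ι → E)
    {R ρ : ℝ} (hR : 0 ≤ R) (hρ : 0 < ρ) (A : Finset ι) (hA : ∀ i ∈ A, dist (x i) x₀ ≤ R) :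
    (#A : ℝ) ^ 2 ≤ (1 + 4 * R / ρ) ^ Module.finrank ℝ E *
      #{ij : ι × ι | dist (x ij.1) (x ij.2) ≤ ρ} := by
  obtain ⟨P, hPA, hsep, hcov⟩ := exists_maximal_separated x (half_pos hρ) A
  choose! c hcP hc using hcov
  have hP := card_le_of_separated_of_mem_closedBall x₀ x hR (half_pos hρ) P
    (fun i hi => hA i (hPA hi)) hsep
  rw [show 2 * R / (ρ / 2) = 4 * R / ρ by field_simp; ring] at hP
  have h_cells : ∑ b ∈ P, #{i ∈ A | c i = b} ^ 2 ≤ #{ij : ι × ι | dist (x ij.1) (x ij.2) ≤ ρ} := by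
    simp only [sq, ← card_product]
    rw [← card_biUnion]
    · refine card_le_card fun ij hij => ?_
      simp only [mem_biUnion, mem_product, mem_filter, mem_univ, true_and] at hij ⊢
      obtain ⟨b, -, ⟨hi, rfl⟩, hj, hcj⟩ := hij
      have h₁ := hc ij.1 hi
      have h₂ := hc ij.2 hj
      rw [hcj] at h₂
      linarith [dist_triangle_right (x ij.1) (x ij.2) (x (c ij.1))]
    · intro b _ b' _ hbb'
      refine disjoint_left.2 fun ij h h' => hbb' ?_
      simp only [mem_product, mem_filter] at h h'
      exact h.1.2.symm.trans h'.1.2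
  have h_card : #A = ∑ b ∈ P, #{i ∈ A | c i = b} := card_eq_sum_card_fiberwise hcP
  calc (#A : ℝ) ^ 2 = (∑ b ∈ P, (#{i ∈ A | c i = b} : ℝ)) ^ 2 := by rw [h_card]; push_cast; rfl
    _ ≤ #P * ∑ b ∈ P, (#{i ∈ A | c i = b} : ℝ) ^ 2 := sq_sum_le_card_mul_sum_sq
    _ ≤ _ := by
      gcongr
      exact_mod_cast h_cells

/-- Ordered near pairs are the diagonal together with both orderings of the unordered ones. -/
lemma card_near_pairs_eq {n : ℕ} {X : Type*} [PseudoMetricSpace X] (x : Fin n → X) {ρ : ℝ}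
    (hρ : 0 ≤ ρ) :
    #{ij : Fin n × Fin n | dist (x ij.1) (x ij.2) ≤ ρ} =
      2 * #{ij : Fin n × Fin n | ij.1 < ij.2 ∧ dist (x ij.1) (x ij.2) ≤ ρ} + n := by
  have h_swap : #{ij : Fin n × Fin n | ij.2 < ij.1 ∧ dist (x ij.1) (x ij.2) ≤ ρ} =
      #{ij : Fin n × Fin n | ij.1 < ij.2 ∧ dist (x ij.1) (x ij.2) ≤ ρ} := by
    refine card_equiv (Equiv.prodComm _ _) fun ij => ?_
    simp [dist_comm]
  have h_diag : #{ij : Fin n × Fin n | ij.1 = ij.2 ∧ dist (x ij.1) (x ij.2) ≤ ρ} = n := by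
    have : ({ij : Fin n × Fin n | ij.1 = ij.2 ∧ dist (x ij.1) (x ij.2) ≤ ρ} : Finset _) =
        (univ : Finset (Fin n)).diag := by
      ext ⟨i, j⟩
      simp only [mem_filter, mem_univ, true_and, mem_diag, and_iff_left_iff_imp]
      rintro rfl
      simpa using hρ
    rw [this, diag_card, card_univ, Fintype.card_fin]
  have h_split : ({ij : Fin n × Fin n | dist (x ij.1) (x ij.2) ≤ ρ} : Finset _) =
      ({ij : Fin n × Fin n | ij.1 < ij.2 ∧ dist (x ij.1) (x ij.2) ≤ ρ} : Finset _) ∪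
      ({ij : Fin n × Fin n | ij.2 < ij.1 ∧ dist (x ij.1) (x ij.2) ≤ ρ} : Finset _) ∪
      ({ij : Fin n × Fin n | ij.1 = ij.2 ∧ dist (x ij.1) (x ij.2) ≤ ρ} : Finset _) := by
    ext ⟨i, j⟩
    simp only [mem_filter, mem_univ, true_and, mem_union]
    have := lt_trichotomy i j
    tauto
  rw [h_split, card_union_of_disjoint, card_union_of_disjoint, h_swap, h_diag]
  · ring
  · refine disjoint_left.2 fun ij h h' => ?_
    simp only [mem_filter, mem_univ, true_and] at h h'
    exact lt_asymm h.1 h'.1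
  · refine disjoint_left.2 fun ij h h' => ?_
    simp only [mem_filter, mem_univ, true_and, mem_union] at h h'
    rcases h with h | h
    exacts [h.1.ne h'.1, h.1.ne' h'.1]


/-- Proposition 5 (analytic core, line-projection LSH of Indyk–Motwani, `ρ(s) = 1/s`):
with `M = (1 + 4α/β)^{d/2} √(2N_β + n)` and `K = (1/α)·log M / log(1/p)`,
`p^{-K} (1 + Σ_{i : ‖x_i − x₀‖ ≥ αr} p^{K‖x_i − x₀‖/r})
  ≤ 3 (1 + 4α/β)^{d/(2α)} (2N_β + n)^{1/(2α)}`. -/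
theorem lsh_query_bound_line_projection {d n : ℕ} (hn : 0 < n)
    (x₀ : EuclideanSpace ℝ (Fin d)) (x : Fin n → EuclideanSpace ℝ (Fin d))
    (r β α p : ℝ) (hr : 0 < r) (hβ : 0 < β) (hα : 1 ≤ α) (hp0 : 0 < p) (hp1 : p < 1)
    (Nβ : ℕ)
    (hNβ : Nβ = (Finset.univ.filter fun ij : Fin n × Fin n =>
        ij.1 < ij.2 ∧ dist (x ij.1) (x ij.2) ≤ β * r).card)
    (M K : ℝ)
    (hM : M = (1 + 4 * α / β) ^ ((d : ℝ) / 2) * Real.sqrt (2 * (Nβ : ℝ) + (n : ℝ)))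
    (hK : K = (1 / α) * Real.log M / Real.log (1 / p)) :
    p ^ (-K) * (1 + ∑ i ∈ Finset.univ.filter fun i : Fin n => α * r ≤ dist (x i) x₀,
        p ^ (K * dist (x i) x₀ / r)) ≤
      3 * (1 + 4 * α / β) ^ ((d : ℝ) / (2 * α)) *
        (2 * (Nβ : ℝ) + (n : ℝ)) ^ ((1 : ℝ) / (2 * α)) := by
  set a : ℝ := 4 * α / β with ha
  set T : ℝ := 2 * (Nβ : ℝ) + n with hT
  have hα0 : 0 < α := by linarith
  have ha0 : 0 < a := by positivity
  have hn1 : (1 : ℝ) ≤ n := by exact_mod_cast hn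
  have hnT : (n : ℝ) ≤ T := by simp [hT]
  have hT1 : 1 ≤ T := hn1.trans hnT
  have hS1 : 1 ≤ √T := Real.one_le_sqrt.2 hT1
  have hST : √T ^ 2 = T := Real.sq_sqrt (by linarith)
  have hE1 : 1 ≤ (1 + a) ^ ((d : ℝ) / 2) := Real.one_le_rpow (by linarith) (by positivity)
  have hM1 : 1 ≤ M := hM ▸ one_le_mul_of_one_le_of_one_le hE1 hS1
  have hM0 : 0 < M := by linarith
  have hlogp : Real.log p ≠ 0 := (Real.log_neg hp0 hp1).ne
  have hpow (y : ℝ) : p ^ (K * y) = M ^ (-(y / α)) := by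
    rw [Real.rpow_def_of_pos hp0, Real.rpow_def_of_pos hM0, hK, one_div p, Real.log_inv]
    congr 1
    field_simp
  have h_prefactor : p ^ (-K) = (1 + a) ^ ((d : ℝ) / (2 * α)) * T ^ ((1 : ℝ) / (2 * α)) := by
    rw [show -K = K * (-1) by ring, hpow, hM, Real.sqrt_eq_rpow,
      Real.mul_rpow (by positivity) (by positivity), ← Real.rpow_mul (by positivity),
      ← Real.rpow_mul (by positivity)]
    congr 2 <;> field_simp
  have h_near : (#{ij : Fin n × Fin n | dist (x ij.1) (x ij.2) ≤ β * r} : ℝ) = T := by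
    rw [card_near_pairs_eq x (by positivity), ← hNβ, hT]
    push_cast
    rfl
  have h_sum : ∑ i ∈ univ.filter fun i : Fin n => α * r ≤ dist (x i) x₀,
      p ^ (K * dist (x i) x₀ / r) ≤ 2 := by
    let f : ℕ → ℝ := fun k => if k = 0 then M⁻¹ else min M⁻¹ (M / (k : ℝ) ^ 2)
    have hf : Antitone f := by
      intro k l hkl
      by_cases hk : k = 0
      · simp only [f, hk, if_true]
        split_ifs
        exacts [le_rfl, min_le_left _ _]
      · have hl : l ≠ 0 := by lia
        have hk0 : (0 : ℝ) < k := by exact_mod_cast Nat.pos_of_ne_zero hk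
        simp only [f, hk, hl, if_false]
        gcongr
    refine (Finset.sum_le_sum_range_of_le_rank f hf (fun i => dist (x i) x₀) _ _
      fun i hi => ?_).trans (by simpa [f] using sum_range_min_inv_div_sq_le_two hM0 _)
    have hτ : 1 ≤ dist (x i) x₀ / (α * r) := by
      rw [one_le_div (by positivity)]
      exact (mem_filter.1 hi).2
    set τ := dist (x i) x₀ / (α * r) with hτ_def
    set A : Finset (Fin n) :=
      {j ∈ univ.filter fun i : Fin n => α * r ≤ dist (x i) x₀ | dist (x j) x₀ ≤ dist (x i) x₀}
      with hA
    have hA0 : 0 < #A := card_pos.2 ⟨i, mem_filter.2 ⟨hi, le_rfl⟩⟩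
    have hw : p ^ (K * dist (x i) x₀ / r) = (M ^ τ)⁻¹ := by
      rw [mul_div_assoc, hpow, Real.rpow_neg hM0.le, hτ_def]
      congr 2
      field_simp
    have h_count : (#A : ℝ) ^ 2 ≤ (1 + 4 * dist (x i) x₀ / (β * r)) ^ d * T := by
      have := card_sq_le_mul_card_near_pairs x₀ x dist_nonneg (mul_pos hβ hr) A
        fun j hj => (mem_filter.1 hj).2
      rwa [h_near, finrank_euclideanSpace_fin] at this
    have h_bernoulli : 1 + 4 * dist (x i) x₀ / (β * r) ≤ (1 + a) ^ τ := by
      have h := one_add_mul_self_le_rpow_one_add (show -1 ≤ a by linarith) hτ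
      have h_eq : τ * a = 4 * dist (x i) x₀ / (β * r) := by
        rw [hτ_def, ha]
        field_simp
      rwa [h_eq] at h
    have hkE : (#A : ℝ) ≤ √T * ((1 + a) ^ ((d : ℝ) / 2)) ^ τ := by
      refine (sq_le_sq₀ (by positivity) (by positivity)).1 ?_
      calc (#A : ℝ) ^ 2 ≤ ((1 + a) ^ τ) ^ d * T := h_count.trans (by gcongr)
        _ = (√T * ((1 + a) ^ ((d : ℝ) / 2)) ^ τ) ^ 2 := by
          have h1a : 0 ≤ 1 + a := by positivity
          rw [mul_pow, hST, ← Real.rpow_natCast, ← Real.rpow_natCast _ 2, ← Real.rpow_mul h1a,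
            ← Real.rpow_mul h1a, ← Real.rpow_mul h1a, mul_comm]
          congr 2
          push_cast
          ring
    have hkS : (#A : ℝ) ≤ √T ^ 2 := by
      rw [hST]
      refine le_trans ?_ hnT
      exact_mod_cast (card_le_univ A).trans_eq (Fintype.card_fin n)
    have h_rank := sq_le_mul_rpow_add_one hS1 hE1 hτ (Nat.cast_nonneg _) hkE hkS
    rw [← hM, Real.rpow_add_one hM0.ne'] at h_rank
    have hk0 : (0 : ℝ) < #A := by exact_mod_cast hA0
    have hMτ : 0 < M ^ τ := by positivity
    simp only [f, hA0.ne', if_false, hw]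
    refine le_min ?_ ?_
    · gcongr
      exact Real.self_le_rpow_of_one_le hM1 hτ
    · rw [le_div_iff₀ (by positivity), inv_mul_le_iff₀ hMτ]
      exact h_rank
  rw [h_prefactor]
  calc _ ≤ (1 + a) ^ ((d : ℝ) / (2 * α)) * T ^ ((1 : ℝ) / (2 * α)) * (1 + 2) := by gcongr
    _ = _ := by ring
end

section
/- Let x_0, x_1, …, x_n ∈ ℝ^d with n ≥ 1, let r > 0, β > 0, p ∈ (0,1), and let ρ : [α, ∞) → (0, ∞) be a monotonically decreasing function defined at some α ≥ 1. Suppose μ > α satisfies ρ(μ) = ρ(α)/2, and suppose the finite set {x_0, x_1, …, x_n} (with the Euclidean metric) has doubling dimension at most d_0 + 1, i.e., every subset Y of it can be covered by at most 2^{d_0+1} subsets each of diameter at most half the diameter of Y. Let N_β = |{(i,j) : 1 ≤ i < j ≤ n, ‖x_i − x_j‖₂ ≤ βr}|, set M = (1 + 4μ/β)^{(d_0+1)/2} · √(2N_β + 2n), and choose the real parameter K = ρ(α) · log M / log(1/p) (so that p^K = M^{−ρ(α)}). Then p^{−K} · (1 + Σ_{i : ‖x_i − x_0‖₂ ≥ αr}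 p^{K/ρ(‖x_i − x_0‖₂ / r)}) ≤ 3 · M^{ρ(α)}. -/
/-- Iterating the doubling property `k` times colours a set with `N ^ k` colours so that points of
the same colour are within `2⁻ᵏ` times the diameter. -/
theorem exists_coloring_edist_le_of_doubling {E : Type*} [PseudoEMetricSpace E] {S : Set E} {N : ℕ}
    (hN : 0 < N)
    (h : ∀ Y ⊆ S, ∃ f : Fin N → Set E,
      Y ⊆ ⋃ i, f i ∧ ∀ i, Metric.ediam (f i) ≤ Metric.ediam Y / 2)
    (k : ℕ) (Y : Set E) (hY : Y ⊆ S) :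
    ∃ c : E → (Fin k → Fin N), ∀ y ∈ Y, ∀ z ∈ Y, c y = c z →
      edist y z ≤ Metric.ediam Y / 2 ^ k := by
  induction k generalizing Y with
  | zero =>
    exact ⟨fun _ => Fin.elim0, fun y hy z hz _ => by
      simpa using Metric.edist_le_ediam_of_mem hy hz⟩
  | succ k ih =>
    obtain ⟨f, hf, hd⟩ := h Y hY
    choose c hc using fun i => ih (Y ∩ f i) (Set.inter_subset_left.trans hY)
    have hex : ∀ y, ∃ i : Fin N, y ∈ Y → y ∈ f i := fun y => by
      by_cases hy : y ∈ Y
      · obtain ⟨i, hi⟩ := Set.mem_iUnion.1 (hf hy)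
        exact ⟨i, fun _ => hi⟩
      · exact ⟨⟨0, hN⟩, fun h => absurd h hy⟩
    choose g hg using hex
    refine ⟨fun y => Fin.cons (g y) (c (g y) y), fun y hy z hz hyz => ?_⟩
    obtain ⟨h1, h2⟩ := Fin.cons_inj.1 hyz
    rw [← h1] at h2
    refine (hc (g y) y ⟨hy, hg y hy⟩ z ⟨hz, h1 ▸ hg z hz⟩ h2).trans ?_
    calc Metric.ediam (Y ∩ f (g y)) / 2 ^ k ≤ Metric.ediam Y / 2 / 2 ^ k := by
          gcongr
          exact (Metric.ediam_mono Set.inter_subset_right).trans (hd _)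
      _ = Metric.ediam Y / 2 ^ (k + 1) := by
          rw [div_eq_mul_inv, div_eq_mul_inv, div_eq_mul_inv, mul_assoc, pow_succ',
            ENNReal.mul_inv (by simp) (by simp)]

/-- By Cauchy–Schwarz, a colouring of `A` has at least `|A|² / #colours` monochromatic pairs. -/
theorem card_sq_le_card_mul_card_monochromatic {ι κ : Type*} [Fintype κ] [DecidableEq κ]
    (A : Finset ι) (c : ι → κ) :
    A.card ^ 2 ≤ Fintype.card κ * ((A ×ˢ A).filter fun ij => c ij.1 = c ij.2).card := by
  have h1 : A.card = ∑ k, (A.filter fun i => c i = k).card :=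
    Finset.card_eq_sum_card_fiberwise fun _ _ => Finset.mem_coe.2 (Finset.mem_univ _)
  have h2 : ((A ×ˢ A).filter fun ij => c ij.1 = c ij.2).card
      = ∑ k, (A.filter fun i => c i = k).card ^ 2 := by
    rw [Finset.card_eq_sum_card_fiberwise (f := fun ij : ι × ι => c ij.1) (t := Finset.univ)
      fun _ _ => Finset.mem_coe.2 (Finset.mem_univ _)]
    refine Finset.sum_congr rfl fun k _ => ?_
    rw [sq, ← Finset.card_product]
    congr 1
    ext ⟨i, j⟩
    simp only [Finset.mem_filter, Finset.mem_product]
    grind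
  rw [h2]
  nth_rewrite 1 [h1]
  exact sq_sum_le_card_mul_sum_sq

/-- The number of ordered pairs satisfying a reflexive symmetric relation. -/
theorem card_filter_rel_eq {n : ℕ} (R : Fin n → Fin n → Prop) [DecidableRel R]
    (hrefl : ∀ i, R i i) (hsymm : ∀ i j, R i j → R j i) :
    (Finset.univ.filter fun ij : Fin n × Fin n => R ij.1 ij.2).card
      = 2 * (Finset.univ.filter fun ij : Fin n × Fin n => ij.1 < ij.2 ∧ R ij.1 ij.2).card + n := by
  have hgt : (Finset.univ.filter fun ij : Fin n × Fin n => ij.2 < ij.1 ∧ R ij.1 ij.2).card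
      = (Finset.univ.filter fun ij : Fin n × Fin n => ij.1 < ij.2 ∧ R ij.1 ij.2).card :=
    Finset.card_bij (fun ij _ => ij.swap)
      (by simpa using fun i j hij hR => ⟨hij, hsymm _ _ hR⟩)
      (fun _ _ _ _ h => Prod.swap_injective h)
      (fun ij hij => ⟨ij.swap, by
        simp only [Finset.mem_filter, Finset.mem_univ, true_and] at hij ⊢
        exact ⟨hij.1, hsymm _ _ hij.2⟩, by simp⟩)
  have heq : (Finset.univ.filter fun ij : Fin n × Fin n => ij.1 = ij.2).card = n := by
    have : (Finset.univ.filter fun ij : Fin n × Fin n => ij.1 = ij.2)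
        = Finset.univ.image fun i => (i, i) := by
      ext ⟨i, j⟩
      simp
    rw [this, Finset.card_image_of_injective _ fun i j h => (Prod.mk.inj h).1, Finset.card_univ,
      Fintype.card_fin]
  have hsplit : (Finset.univ.filter fun ij : Fin n × Fin n => R ij.1 ij.2)
      = ((Finset.univ.filter fun ij : Fin n × Fin n => ij.1 < ij.2 ∧ R ij.1 ij.2) ∪
        (Finset.univ.filter fun ij : Fin n × Fin n => ij.2 < ij.1 ∧ R ij.1 ij.2)) ∪
        (Finset.univ.filter fun ij : Fin n × Fin n => ij.1 = ij.2) := by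
    ext ⟨i, j⟩
    simp only [Finset.mem_filter, Finset.mem_univ, true_and, Finset.mem_union]
    rcases lt_trichotomy i j with h | h | h
    · simp [h, h.not_gt, h.ne]
    · simp [h, hrefl]
    · simp [h, h.not_gt, h.ne']
  rw [hsplit, Finset.card_union_of_disjoint, Finset.card_union_of_disjoint, hgt, heq]
  · ring
  · rw [Finset.disjoint_filter]
    exact fun _ _ h h' => absurd h.1 h'.1.not_gt
  · rw [Finset.disjoint_left]
    simp only [Finset.mem_filter, Finset.mem_univ, true_and, Finset.mem_union]
    rintro ij (h | h) h'
    · exact h.1.ne h'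
    · exact h.1.ne' h'

/-- Every positive real is at most a power of two that is at most `1 + 2t`. -/
theorem exists_two_pow_between {t : ℝ} (ht : 0 < t) :
    ∃ k : ℕ, t ≤ 2 ^ k ∧ (2 : ℝ) ^ k ≤ 1 + 2 * t := by
  rcases le_total t 1 with h | h
  · exact ⟨0, by simpa using h, by simpa using ht.le⟩
  · obtain ⟨k, hk, hk'⟩ := exists_nat_pow_near h one_lt_two
    exact ⟨k + 1, hk'.le, by rw [pow_succ]; linarith⟩

/-- The number of points of a doubling set in a ball of radius `s` is controlled by the number
of pairs at distance at most `b`. -/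
theorem card_ball_sq_le_of_doubling {E : Type*} [PseudoMetricSpace E] {n D : ℕ}
    (x₀ : E) (x : Fin n → E) {s b : ℝ} (hs : 0 < s) (hb : 0 < b)
    (hdbl : ∀ Y ⊆ insert x₀ (Set.range x), ∃ f : Fin (2 ^ D) → Set E,
      Y ⊆ ⋃ i, f i ∧ ∀ i, Metric.ediam (f i) ≤ Metric.ediam Y / 2) :
    ((Finset.univ.filter fun i => dist (x i) x₀ ≤ s).card : ℝ) ^ 2 ≤ (1 + 4 * s / b) ^ D *
      (2 * (Finset.univ.filter fun ij : Fin n × Fin n =>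
        ij.1 < ij.2 ∧ dist (x ij.1) (x ij.2) ≤ b).card + n) := by
  obtain ⟨k, hk, hk'⟩ := exists_two_pow_between (t := 2 * s / b) (by positivity)
  set A := Finset.univ.filter fun i => dist (x i) x₀ ≤ s with hA
  obtain ⟨c, hc⟩ := exists_coloring_edist_le_of_doubling (by positivity) hdbl k
    (x '' A) ((Set.image_subset_range _ _).trans (Set.subset_insert _ _))
  have hdiam : Metric.ediam (x '' A) ≤ ENNReal.ofReal (2 * s) := by
    refine Metric.ediam_le ?_
    rintro _ ⟨i, hi, rfl⟩ _ ⟨j, hj, rfl⟩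
    simp only [hA, Finset.coe_filter, Finset.mem_univ, true_and, Set.mem_ofPred_eq] at hi hj
    rw [edist_dist]
    exact ENNReal.ofReal_le_ofReal (by linarith [dist_triangle_right (x i) (x j) x₀])
  have hnear : ∀ i ∈ A, ∀ j ∈ A, c (x i) = c (x j) → dist (x i) (x j) ≤ b := by
    intro i hi j hj hij
    have h1 := (hc _ ⟨i, hi, rfl⟩ _ ⟨j, hj, rfl⟩ hij).trans (ENNReal.div_le_div_right hdiam _)
    have h2 : ENNReal.ofReal (2 * s) / 2 ^ k = ENNReal.ofReal (2 * s / 2 ^ k) := by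
      rw [ENNReal.ofReal_div_of_pos (by positivity), ENNReal.ofReal_pow zero_le_two]
      simp
    rw [h2, edist_dist, ENNReal.ofReal_le_ofReal_iff (by positivity)] at h1
    refine h1.trans ?_
    rw [div_le_iff₀ hb] at hk
    rw [div_le_iff₀ (by positivity)]
    linarith
  have hcs := card_sq_le_card_mul_card_monochromatic A fun i => c (x i)
  have hpairs : ((A ×ˢ A).filter fun ij => c (x ij.1) = c (x ij.2)).card ≤
      2 * (Finset.univ.filter fun ij : Fin n × Fin n =>
        ij.1 < ij.2 ∧ dist (x ij.1) (x ij.2) ≤ b).card + n := by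
    rw [← card_filter_rel_eq (fun i j => dist (x i) (x j) ≤ b) (fun i => by simpa using hb.le)
      fun i j h => by rwa [dist_comm]]
    refine Finset.card_le_card fun ij hij => ?_
    simp only [Finset.mem_filter, Finset.mem_product] at hij
    simpa using hnear _ hij.1.1 _ hij.1.2 hij.2
  have hcol : (Fintype.card (Fin k → Fin (2 ^ D)) : ℝ) ≤ (1 + 4 * s / b) ^ D := by
    rw [Fintype.card_fun, Fintype.card_fin, Fintype.card_fin]
    push_cast
    rw [← pow_mul, mul_comm, pow_mul]
    refine pow_le_pow_left₀ (by positivity) (hk'.trans_eq ?_) _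
    ring
  calc (A.card : ℝ) ^ 2 ≤ (Fintype.card (Fin k → Fin (2 ^ D)) : ℝ) *
        (2 * (Finset.univ.filter fun ij : Fin n × Fin n =>
          ij.1 < ij.2 ∧ dist (x ij.1) (x ij.2) ≤ b).card + n : ℕ) := by
        exact_mod_cast hcs.trans (Nat.mul_le_mul_left _ hpairs)
    _ ≤ _ := by
        push_cast
        gcongr


/-- Theorem 7 (analytic core, doubling dimension): if `{x₀, x₁, …, xₙ}` has doubling
dimension at most `d₀ + 1`, `ρ(μ) = ρ(α)/2`,
`M = (1 + 4μ/β)^{(d₀+1)/2} √(2N_β + 2n)` and `K = ρ(α)·log M / log(1/p)`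
(so `p^K = M^{-ρ(α)}`), then
`p^{-K} (1 + Σ_{i : ‖x_i − x₀‖ ≥ αr} p^{K/ρ(‖x_i − x₀‖/r)}) ≤ 3 M^{ρ(α)}`. -/
theorem doubling_lsh_query_bound {d n : ℕ} (hn : 0 < n)
    (x₀ : EuclideanSpace ℝ (Fin d)) (x : Fin n → EuclideanSpace ℝ (Fin d))
    (r α β p : ℝ) (hr : 0 < r) (hα : 1 ≤ α) (hβ : 0 < β) (hp0 : 0 < p) (hp1 : p < 1)
    (ρ : ℝ → ℝ) (hρpos : ∀ s, α ≤ s → 0 < ρ s) (hρdec : AntitoneOn ρ (Set.Ici α))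
    (μ : ℝ) (hμ : α < μ) (hρμ : ρ μ = ρ α / 2)
    (d₀ : ℕ)
    (hdbl : ∀ Y : Set (EuclideanSpace ℝ (Fin d)), Y ⊆ insert x₀ (Set.range x) →
      ∃ f : Fin (2 ^ (d₀ + 1)) → Set (EuclideanSpace ℝ (Fin d)),
        Y ⊆ ⋃ i, f i ∧ ∀ i, EMetric.diam (f i) ≤ EMetric.diam Y / 2)
    (Nβ : ℕ)
    (hNβ : Nβ = (Finset.univ.filter fun ij : Fin n × Fin n =>
        ij.1 < ij.2 ∧ dist (x ij.1) (x ij.2) ≤ β * r).card)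
    (M K : ℝ)
    (hM : M = (1 + 4 * μ / β) ^ (((d₀ : ℝ) + 1) / 2) *
        Real.sqrt (2 * (Nβ : ℝ) + 2 * (n : ℝ)))
    (hK : K = ρ α * Real.log M / Real.log (1 / p)) :
    p ^ (-K) * (1 + ∑ i ∈ Finset.univ.filter fun i : Fin n => α * r ≤ dist (x i) x₀,
        p ^ (K / ρ (dist (x i) x₀ / r))) ≤ 3 * M ^ ρ α := by
  have hμ0 : 0 < μ := by linarith
  have hn1 : (1 : ℝ) ≤ n := by exact_mod_cast hn
  have hNβ0 : (0 : ℝ) ≤ Nβ := Nat.cast_nonneg _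
  have hB : 1 ≤ 1 + 4 * μ / β := le_add_of_nonneg_right (by positivity)
  have hM0 : 0 ≤ M := by rw [hM]; positivity
  have hM2 : M ^ 2 = (1 + 4 * μ / β) ^ (d₀ + 1) * (2 * (Nβ : ℝ) + 2 * n) := by
    rw [hM, mul_pow, Real.sq_sqrt (by positivity), ← Real.rpow_natCast, ← Real.rpow_mul (by positivity),
      ← Real.rpow_natCast]
    congr 2
    push_cast
    ring
  have hM2n : 2 * (n : ℝ) ≤ M ^ 2 := by
    rw [hM2]
    nlinarith [one_le_pow₀ hB (n := d₀ + 1)]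
  have hM1 : 1 ≤ M := by nlinarith
  have hMpos : 0 < M := by linarith
  have hlogp : Real.log p < 0 := Real.log_neg hp0 hp1
  have hpow : ∀ t : ℝ, p ^ (K * t) = M ^ (-(ρ α * t)) := by
    intro t
    rw [Real.rpow_def_of_pos hp0, Real.rpow_def_of_pos hMpos, hK, one_div, Real.log_inv]
    congr 1
    have := hlogp.ne
    field_simp
  have hρα : 0 < ρ α := hρpos α le_rfl
  have hterm : ∀ s, α ≤ s → p ^ (K / ρ s) ≤ M⁻¹ := by
    intro s hs
    have h1 := hρpos s hs
    have h2 := hρdec (Set.mem_Ici.2 le_rfl) hs hs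
    rw [div_eq_mul_inv, hpow, ← Real.rpow_neg_one M]
    refine Real.rpow_le_rpow_of_exponent_le hM1 (neg_le_neg ?_)
    rwa [← div_eq_mul_inv, one_le_div h1]
  have hterm' : ∀ s, μ ≤ s → p ^ (K / ρ s) ≤ (M ^ 2)⁻¹ := by
    intro s hs
    have h1 := hρpos s (hμ.le.trans hs)
    have h2 := hρdec (Set.mem_Ici.2 hμ.le) (hμ.le.trans hs) hs
    rw [div_eq_mul_inv, hpow, ← Real.rpow_natCast, ← Real.rpow_neg hM0]
    refine Real.rpow_le_rpow_of_exponent_le hM1 (neg_le_neg ?_)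
    rw [← div_eq_mul_inv, le_div_iff₀ h1]
    push_cast
    linarith
  have hball : ((Finset.univ.filter fun i => dist (x i) x₀ ≤ μ * r).card : ℝ) ≤ M := by
    refine (sq_le_sq₀ (Nat.cast_nonneg _) hM0).1 ?_
    have h := card_ball_sq_le_of_doubling x₀ x (mul_pos hμ0 hr) (mul_pos hβ hr) hdbl
    rw [← hNβ, show 4 * (μ * r) / (β * r) = 4 * μ / β by field_simp] at h
    rw [hM2]
    refine h.trans ?_
    gcongr
    linarith
  have hbound : ∀ i ∈ Finset.univ.filter fun i : Fin n => α * r ≤ dist (x i) x₀,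
      p ^ (K / ρ (dist (x i) x₀ / r)) ≤
        (if dist (x i) x₀ ≤ μ * r then M⁻¹ else 0) + (M ^ 2)⁻¹ := by
    intro i hi
    have hi' : α ≤ dist (x i) x₀ / r := (le_div_iff₀ hr).2 (Finset.mem_filter.1 hi).2
    split_ifs with h
    · exact (hterm _ hi').trans (le_add_of_nonneg_right (by positivity))
    · rw [zero_add]
      exact hterm' _ ((le_div_iff₀ hr).2 (not_le.1 h).le)
  have hsum : ∑ i ∈ Finset.univ.filter fun i : Fin n => α * r ≤ dist (x i) x₀,
      p ^ (K / ρ (dist (x i) x₀ / r)) ≤ 2 := by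
    calc _ ≤ ∑ i ∈ Finset.univ.filter fun i : Fin n => α * r ≤ dist (x i) x₀,
          ((if dist (x i) x₀ ≤ μ * r then M⁻¹ else 0) + (M ^ 2)⁻¹) := Finset.sum_le_sum hbound
      _ ≤ ∑ i : Fin n, ((if dist (x i) x₀ ≤ μ * r then M⁻¹ else 0) + (M ^ 2)⁻¹) :=
          Finset.sum_le_sum_of_subset_of_nonneg (Finset.filter_subset _ _) fun i _ _ => by
            split_ifs <;> positivity
      _ = (Finset.univ.filter fun i => dist (x i) x₀ ≤ μ * r).card * M⁻¹ + n * (M ^ 2)⁻¹ := by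
          rw [Finset.sum_add_distrib, ← Finset.sum_filter]
          simp
      _ ≤ 1 + 1 := by
          refine add_le_add ?_ ?_
          · rw [← div_eq_mul_inv]
            exact div_le_one_of_le₀ hball hM0
          · rw [← div_eq_mul_inv]
            exact div_le_one_of_le₀ (by linarith) (by positivity)
      _ = 2 := one_add_one_eq_two
  have hpK : p ^ (-K) = M ^ ρ α := by
    simpa using hpow (-1)
  rw [hpK, mul_comm]
  exact mul_le_mul_of_nonneg_right (by linarith) (Real.rpow_nonneg hM0 _)
end

section
/- Let X and B be types with decidable equality on B, let 𝓗 be a probability mass function on the function space X → B, and let x, y ∈ X be such that the probability under h ∼ 𝓗 of the event h(x) = h(y) is at least q, where q ∈ [0,1]. Let K, L ≥ 1 be integers and draw L·K functions h_{11}, …, h_{LK} independently, each with distribution 𝓗 (i.e., according to the L·K-fold product of 𝓗). Then the probability that for every i ∈ {1,…,L} there exists j ∈ {1,…,K} with h_{ij}(x) ≠ h_{ij}(y) is at most (1 − q^K)^L. -/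
open MeasureTheory
open scoped ENNReal

namespace MeasureTheory.Measure

/-- The product measure on `ι × κ → α` agrees, after currying, with the iterated product measure. -/
lemma pi_map_curry {ι κ α : Type*} [Fintype ι] [Fintype κ] [MeasurableSpace α]
    (μ : ι → κ → Measure α) [∀ i j, IsProbabilityMeasure (μ i j)] :
    (Measure.pi fun p : ι × κ ↦ μ p.1 p.2).map (MeasurableEquiv.curry ι κ α) =
      Measure.pi fun i ↦ Measure.pi (μ i) := by
  simpa only [infinitePi_eq_pi] using infinitePi_map_curry μ

/-- For i.i.d. samples indexed by `ι × κ`, the probability that every row leaves `s` somewhere. -/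
lemma pi_forall_exists_notMem {ι κ α : Type*} [Fintype ι] [Fintype κ] [MeasurableSpace α]
    (μ : Measure α) [IsProbabilityMeasure μ] {s : Set α} (hs : MeasurableSet s) :
    Measure.pi (fun _ : ι × κ ↦ μ) {f | ∀ i, ∃ j, f (i, j) ∉ s} =
      (1 - μ s ^ Fintype.card κ) ^ Fintype.card ι := by
  have hset : {f : ι × κ → α | ∀ i, ∃ j, f (i, j) ∉ s} = MeasurableEquiv.curry ι κ α ⁻¹'
      Set.univ.pi fun _ ↦ (Set.univ.pi fun _ ↦ s)ᶜ := by
    ext f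
    simp [MeasurableEquiv.curry, Function.curry]
  rw [hset, ← MeasurableEquiv.map_apply, pi_map_curry (fun _ _ ↦ μ), pi_pi,
    prob_compl_eq_one_sub (MeasurableSet.univ_pi fun _ ↦ hs), pi_pi]
  simp

end MeasureTheory.Measure

/-- If two points `x, y` collide under a hash drawn from `𝓗` with probability at
least `q`, and `L·K` hash functions `h_{ij}` are drawn i.i.d. from `𝓗`, then the
probability that for every `i ∈ {1,…,L}` some `j ∈ {1,…,K}` has
`h_{ij}(x) ≠ h_{ij}(y)` is at most `(1 − q^K)^L`. -/
theorem lsh_miss_probability {X B : Type*} [DecidableEq B]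
    (𝓗 : PMF (X → B)) (x y : X) (q : ℝ≥0∞) (hq : q ≤ 1)
    (hcol : q ≤ 𝓗.toOuterMeasure {h | h x = h y})
    (K L : ℕ) (hK : 1 ≤ K) (hL : 1 ≤ L) :
    (letI : MeasurableSpace (X → B) := ⊤
     Measure.pi (fun _ : Fin L × Fin K => 𝓗.toMeasure)
       {H : Fin L × Fin K → X → B | ∀ i : Fin L, ∃ j : Fin K, H (i, j) x ≠ H (i, j) y})
      ≤ (1 - q ^ K) ^ L := by
  let : MeasurableSpace (X → B) := ⊤
  have hmiss := Measure.pi_forall_exists_notMem (ι := Fin L) (κ := Fin K) 𝓗.toMeasure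
    (s := {h | h x = h y}) MeasurableSpace.measurableSet_top
  rw [𝓗.toMeasure_apply_eq_toOuterMeasure_apply MeasurableSpace.measurableSet_top,
    Fintype.card_fin, Fintype.card_fin] at hmiss
  refine hmiss.le.trans ?_
  gcongr
end
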